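/- Let M_g be a generator ε-machine over finite alphabet 𝒳 with states σ_1,…,σ_N, symbol-labeled matrices {T^(x)}, and stationary distribution π, and let ℙ be the stationary ergodic process it generates, i.e. ℙ(w) = ‖π T^(w)‖₁ for every word w ∈ 𝒳*. Then ℙ is finitely characterized: for each i, the set E_i of regular pasts x⃖ with 𝐏(w|x⃖) = 𝐏_{σ_i}(w) for all w ∈ 𝒳* is measurable with ℙ^-(E_i) = π_i > 0, and Σ_{i=1}^N ℙ^-(E_i) = 1; moreover the correspondence E_i ↔ σ_i is an isomorphism of hidden Markov models: 𝐏(x|E_i) = 𝐏_{σ_i}(x) for every symbol x ∈ 𝒳, and whenever 𝐏_{σ_i}(x) > 0, the class δ_h(E_i, x) containing the pasts x⃖x, x⃖ ∈ E_i, equals E_j for the unique j with T^(x)_{ij} > 0. -/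

import Mathlib

open MeasureTheory Filter Topology
open scoped Classical

namespace EM

variable {X : Type*} [Fintype X] [MeasurableSpace X] [MeasurableSingletonClass X]

/-- The left shift on bi-infinite sequences. -/
def shift (ω : ℤ → X) : ℤ → X := fun n => ω (n + 1)

/-- ℙ(w): probability of the cylinder set of the word `w` at position 0. -/
noncomputable def wordProb (μ : Measure (ℤ → X)) (w : List X) : ℝ :=
  (μ {ω | ∀ k : Fin w.length, ω ((k : ℕ) : ℤ) = w.get k}).toReal

/-- Stationarity: invariance of the measure under the shift. -/
def Stationary (μ : Measure (ℤ → X)) : Prop := Measure.map shift μ = μ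

/-- Ergodicity: every shift-invariant measurable event is trivial. -/
def Ergodic' (μ : Measure (ℤ → X)) : Prop :=
  ∀ A : Set (ℤ → X), MeasurableSet A → shift ⁻¹' A = A → μ A = 0 ∨ μ A = 1

/-- Projection of a bi-infinite sequence to its past:  (pastMap ω) n = x_{-(n+1)}. -/
def pastMap (ω : ℤ → X) : ℕ → X := fun n => ω (-((n : ℤ) + 1))

/-- ℙ⁻ : the marginal of ℙ on past sequences. -/
noncomputable def pastMeasure (μ : Measure (ℤ → X)) : Measure (ℕ → X) :=
  Measure.map pastMap μ

/-- x⃖^t = x_{-t} … x_{-1}, the last `t` symbols of the past `p`, as a word. -/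
def pastWord (p : ℕ → X) (t : ℕ) : List X := (List.range t).reverse.map p

/-- A past is nontrivial if all of its finite suffixes have positive probability. -/
def Nontrivial' (μ : Measure (ℤ → X)) (p : ℕ → X) : Prop :=
  ∀ t : ℕ, 0 < wordProb μ (pastWord p t)

/-- ℙ(w | v) = ℙ(vw)/ℙ(v): conditional probability that `w` follows `v`. -/
noncomputable def condProb (μ : Measure (ℤ → X)) (w v : List X) : ℝ :=
  wordProb μ (v ++ w) / wordProb μ v

/-- A past is `w`-regular if it is nontrivial and lim_{t→∞} ℙ(w|x⃖^t) exists. -/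
def WRegular (μ : Measure (ℤ → X)) (p : ℕ → X) (w : List X) : Prop :=
  Nontrivial' μ p ∧ ∃ L : ℝ, Tendsto (fun t => condProb μ w (pastWord p t)) atTop (𝓝 L)

/-- A past is regular if it is nontrivial and `w`-regular for every nonempty word `w`. -/
def Regular (μ : Measure (ℤ → X)) (p : ℕ → X) : Prop :=
  Nontrivial' μ p ∧ ∀ w : List X, w ≠ [] →
    ∃ L : ℝ, Tendsto (fun t => condProb μ w (pastWord p t)) atTop (𝓝 L)

/-- 𝐏(w|x⃖) = lim_{t→∞} ℙ(w|x⃖^t)  (meaningful for regular pasts). -/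
noncomputable def predProb (μ : Measure (ℤ → X)) (p : ℕ → X) (w : List X) : ℝ :=
  limUnder atTop (fun t => condProb μ w (pastWord p t))

/-- The past x⃖x obtained by appending the symbol `x` to the past x⃖. -/
def extendPast (p : ℕ → X) (x : X) : ℕ → X
  | 0 => x
  | n + 1 => p n

/-- The past obtained by appending a word symbol by symbol. -/
def extendWord (p : ℕ → X) : List X → (ℕ → X)
  | [] => p
  | x :: u => extendWord (extendPast p x) u

/-- The predictive equivalence class of the (regular) past `p`. -/
def classOf (μ : Measure (ℤ → X)) (p : ℕ → X) : Set (ℕ → X) :=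
  {q | Regular μ q ∧ ∀ w : List X, w ≠ [] → predProb μ q w = predProb μ p w}

section HMM

variable {S : Type*} [Fintype S] [DecidableEq S]

/-- T^(w) = T^(w₀) ⋯ T^(w_{l-1}). -/
def wordMatrix (T : X → Matrix S S ℝ) (w : List X) : Matrix S S ℝ :=
  (w.map T).prod

/-- 𝐏_{σ_i}(w) = ‖e_i T^(w)‖₁, the probability of emitting `w` from state `i`. -/
noncomputable def stateWordProb (T : X → Matrix S S ℝ) (i : S) (w : List X) : ℝ :=
  ∑ j, wordMatrix T w i j

/-- All transition matrices have nonnegative entries. -/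
def HMMNonneg (T : X → Matrix S S ℝ) : Prop := ∀ x i j, 0 ≤ T x i j

/-- The overall transition matrix T = Σ_x T^(x) is row-stochastic. -/
def HMMStochastic (T : X → Matrix S S ℝ) : Prop := ∀ i, ∑ x : X, ∑ j, T x i j = 1

/-- The overall state-to-state transition matrix T = Σ_x T^(x). -/
noncomputable def totalT (T : X → Matrix S S ℝ) : Matrix S S ℝ := ∑ x : X, T x

/-- Irreducibility: the directed graph with an edge i → j whenever T_{ij} > 0 is
strongly connected. -/
def Irreducible' (T : X → Matrix S S ℝ) : Prop :=
  ∀ i j : S, ∃ n : ℕ, 0 < n ∧ 0 < (totalT T ^ n) i j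

/-- Unifilarity: from each state, each symbol leads to at most one state. -/
def Unifilar (T : X → Matrix S S ℝ) : Prop :=
  ∀ (x : X) (i j k : S), 0 < T x i j → 0 < T x i k → j = k

/-- Probabilistically distinct states. -/
def ProbDistinct (T : X → Matrix S S ℝ) : Prop :=
  ∀ i j : S, i ≠ j → ∃ w : List X, w ≠ [] ∧ stateWordProb T i w ≠ stateWordProb T j w

/-- π is a stationary distribution for the HMM: π ≥ 0, Σπ = 1, π = πT. -/
def IsStationaryDist (T : X → Matrix S S ℝ) (π : S → ℝ) : Prop :=
  (∀ i, 0 ≤ π i) ∧ (∑ i, π i = 1) ∧ (∀ j, ∑ i, π i * totalT T i j = π j)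

/-- A generator ε-machine: a valid, irreducible, unifilar HMM with
probabilistically distinct states. -/
def IsGenEM (T : X → Matrix S S ℝ) : Prop :=
  HMMNonneg T ∧ HMMStochastic T ∧ Irreducible' T ∧ Unifilar T ∧ ProbDistinct T

/-- The set of regular pasts whose predictions agree with state `i` of the HMM `T`. -/
def stateClass (μ : Measure (ℤ → X)) (T : X → Matrix S S ℝ) (i : S) : Set (ℕ → X) :=
  {q | Regular μ q ∧ ∀ w : List X, w ≠ [] → predProb μ q w = stateWordProb T i w}

end HMM

/-- The symbol-labeled transition matrices of the history ε-machine, given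
representatives `p i` of the positive-probability predictive equivalence classes:
T^(x)_{ij} = 𝐏(x|E_i) if 𝐏(x|E_i) > 0 and δ_h(E_i,x) = E_j, and 0 otherwise. -/
noncomputable def histT (μ : Measure (ℤ → X)) {N : ℕ} (p : Fin N → (ℕ → X)) (x : X) :
    Matrix (Fin N) (Fin N) ℝ := fun i j =>
  if 0 < predProb μ (p i) [x] ∧ classOf μ (extendPast (p i) x) = classOf μ (p j)
  then predProb μ (p i) [x] else 0

/-- ℙ is finitely characterized, with the pasts `p i` representing the finitely many
positive-probability predictive equivalence classes E_i = classOf μ (p i). -/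
def FinitelyCharacterized (μ : Measure (ℤ → X)) {N : ℕ} (p : Fin N → (ℕ → X)) : Prop :=
  (∀ i, Regular μ (p i)) ∧
  (∀ i j : Fin N, i ≠ j → classOf μ (p i) ≠ classOf μ (p j)) ∧
  (∀ i, 0 < pastMeasure μ (classOf μ (p i))) ∧
  (∑ i, pastMeasure μ (classOf μ (p i)) = 1)

end EM

namespace EM

open Matrix

section Words

variable {X : Type*}

/-- The word obtained by reading a tuple from right to left. -/
def revWord {n : ℕ} (a : Fin n → X) : List X := (List.ofFn a).reverse

@[simp]
lemma revWord_zero (a : Fin 0 → X) : revWord a = [] := by simp [revWord]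

lemma revWord_snoc {n : ℕ} (a : Fin n → X) (x : X) :
    revWord (Fin.snoc (α := fun _ => X) a x) = x :: revWord a := by
  rw [revWord, List.ofFn_succ']
  simp [revWord]

lemma revWord_append {m n : ℕ} (a : Fin m → X) (b : Fin n → X) :
    revWord (Fin.append a b) = revWord b ++ revWord a := by
  simp [revWord, List.ofFn_fin_append]

lemma revWord_get_reverse (w : List X) : revWord (fun k => w.reverse.get k) = w := by
  simp only [revWord, List.ofFn_get, List.reverse_reverse]

lemma pastWord_eq_revWord (p : ℕ → X) (t : ℕ) :
    pastWord p t = revWord (fun k : Fin t => p k) := by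
  rw [pastWord, revWord, List.map_reverse]
  congr 1
  apply List.ext_getElem <;> simp

lemma pastWord_extendPast (p : ℕ → X) (x : X) (t : ℕ) :
    pastWord (extendPast p x) (t + 1) = pastWord p t ++ [x] := by
  simp [pastWord, List.range_succ_eq_map, extendPast, Function.comp_def]

variable [Fintype X]

lemma sum_revWord_succ {n : ℕ} {M : Type*} [AddCommMonoid M] (h : (Fin (n + 1) → X) → M) :
    ∑ u, h u = ∑ a : Fin n → X, ∑ x, h (Fin.snoc (α := fun _ => X) a x) := by
  rw [← (Fin.snocEquiv (fun _ => X)).sum_comp, Fintype.sum_prod_type, Finset.sum_comm]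
  rfl

lemma sum_revWord_add {m n : ℕ} (h : List X → ℝ) :
    ∑ u : Fin (m + n) → X, h (revWord u) =
      ∑ b : Fin n → X, ∑ a : Fin m → X, h (revWord b ++ revWord a) := by
  rw [← (Fin.appendEquiv m n).sum_comp, Fintype.sum_prod_type, Finset.sum_comm]
  simp [Fin.appendEquiv, revWord_append]

end Words

section Algebra

variable {X : Type*} {S : Type*} [Fintype S] [DecidableEq S] {T : X → Matrix S S ℝ}

lemma wordMatrix_nil : wordMatrix T [] = 1 := rfl

lemma wordMatrix_cons (x : X) (w : List X) :
    wordMatrix T (x :: w) = T x * wordMatrix T w := by simp [wordMatrix]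

lemma wordMatrix_append (v w : List X) :
    wordMatrix T (v ++ w) = wordMatrix T v * wordMatrix T w := by simp [wordMatrix]

lemma HMMNonneg.wordMatrix (h : HMMNonneg T) (w : List X) (i j : S) :
    0 ≤ wordMatrix T w i j := by
  induction w generalizing i with
  | nil => rw [wordMatrix_nil, Matrix.one_apply]; split_ifs <;> norm_num
  | cons x w ih =>
    rw [wordMatrix_cons, Matrix.mul_apply]
    exact Finset.sum_nonneg fun k _ => mul_nonneg (h x i k) (ih k)

lemma HMMNonneg.stateWordProb (h : HMMNonneg T) (i : S) (w : List X) :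
    0 ≤ stateWordProb T i w :=
  Finset.sum_nonneg fun _ _ => h.wordMatrix _ _ _

/-- Each row of each symbol matrix has at most one nonzero entry, and so has each row of each
word matrix. -/
lemma Unifilar.wordMatrix (hn : HMMNonneg T) (h : Unifilar T) (w : List X) (i j k : S)
    (hj : 0 < wordMatrix T w i j) (hk : 0 < wordMatrix T w i k) : j = k := by
  induction w generalizing i with
  | nil =>
    rw [wordMatrix_nil, Matrix.one_apply] at hj hk
    split_ifs at hj hk <;> simp_all
  | cons x w ih =>
    rw [wordMatrix_cons, Matrix.mul_apply] at hj hk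
    obtain ⟨a, -, ha⟩ := Finset.exists_ne_zero_of_sum_ne_zero hj.ne'
    obtain ⟨b, -, hb⟩ := Finset.exists_ne_zero_of_sum_ne_zero hk.ne'
    have pos : ∀ {l m : S}, T x i l * EM.wordMatrix T w l m ≠ 0 →
        0 < T x i l ∧ 0 < EM.wordMatrix T w l m := fun {l m} hne =>
      ⟨(hn x i l).lt_of_ne' (left_ne_zero_of_mul hne),
        (hn.wordMatrix w l m).lt_of_ne' (right_ne_zero_of_mul hne)⟩
    obtain rfl := h x i a b (pos ha).1 (pos hb).1
    exact ih a (pos ha).2 (pos hb).2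

lemma stateWordProb_cons (x : X) (w : List X) (i : S) :
    stateWordProb T i (x :: w) = ∑ j, T x i j * stateWordProb T j w := by
  simp_rw [stateWordProb, wordMatrix_cons, Matrix.mul_apply, Finset.mul_sum]
  exact Finset.sum_comm

lemma stateWordProb_cons_of_pos (hn : HMMNonneg T) (h : Unifilar T) {x : X} {i j : S}
    (hx : 0 < T x i j) (w : List X) :
    stateWordProb T i (x :: w) = T x i j * stateWordProb T j w := by
  rw [stateWordProb_cons]
  refine Finset.sum_eq_single j (fun k _ hk => ?_) (by simp)
  have : T x i k = 0 := by
    by_contra hne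
    exact hk (h x i k j ((hn x i k).lt_of_ne' hne) hx)
  simp [this]

lemma stateWordProb_nil (i : S) : stateWordProb T i [] = 1 := by
  simp [stateWordProb, wordMatrix_nil, Matrix.one_apply]

lemma sum_stateWordProb [Fintype X] (h : HMMStochastic T) (n : ℕ) (i : S) :
    ∑ a : Fin n → X, stateWordProb T i (revWord a) = 1 := by
  induction n generalizing i with
  | zero => simp [stateWordProb_nil]
  | succ n ih =>
    simp_rw [sum_revWord_succ, revWord_snoc, stateWordProb_cons]
    rw [Finset.sum_comm, ← h i]
    refine Finset.sum_congr rfl fun x _ => ?_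
    rw [Finset.sum_comm]
    simp_rw [← Finset.mul_sum, ih, mul_one]

lemma sum_vecMul_wordMatrix (m : S → ℝ) (w : List X) :
    ∑ j, (m ᵥ* wordMatrix T w) j = ∑ i, m i * stateWordProb T i w := by
  simp_rw [vecMul, dotProduct, stateWordProb, Finset.mul_sum]
  exact Finset.sum_comm

/-- Squares are superadditive, and unifilarity keeps the mass of a state together. -/
lemma sum_sq_le_sum_sq_vecMul (hn : HMMNonneg T) (h : Unifilar T) {m : S → ℝ}
    (hm : ∀ i, 0 ≤ m i) (w : List X) :
    ∑ i, (m i) ^ 2 * stateWordProb T i w ^ 2 ≤ ∑ j, (m ᵥ* wordMatrix T w) j ^ 2 := by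
  have row : ∀ i, stateWordProb T i w ^ 2 = ∑ j, wordMatrix T w i j ^ 2 := by
    intro i
    by_cases hi : ∃ j, 0 < wordMatrix T w i j
    · obtain ⟨j, hj⟩ := hi
      have hz : ∀ k, k ≠ j → wordMatrix T w i k = 0 := fun k hk => by
        by_contra hne
        exact hk (h.wordMatrix hn w i k j ((hn.wordMatrix w i k).lt_of_ne' hne) hj)
      rw [stateWordProb, Finset.sum_eq_single j (fun k _ hk => hz k hk) (by simp),
        Finset.sum_eq_single j (fun k _ hk => by simp [hz k hk]) (by simp)]
    · push Not at hi
      have hz : ∀ k, wordMatrix T w i k = 0 := fun k => le_antisymm (hi k) (hn.wordMatrix w i k)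
      simp [stateWordProb, hz]
  simp_rw [row, Finset.mul_sum, ← mul_pow]
  rw [Finset.sum_comm]
  exact Finset.sum_le_sum fun j _ =>
    Finset.sum_sq_le_sq_sum_of_nonneg fun i _ => mul_nonneg (hm i) (hn.wordMatrix w i j)

/-- Reading a word on average increases the purity (sum of squares) of the conditional state
distribution, with a gain controlled by how well the word discriminates the states. -/
lemma purity_gain [Fintype X] (hn : HMMNonneg T) (hs : HMMStochastic T) (h : Unifilar T)
    {m : S → ℝ} (hm : ∀ i, 0 ≤ m i) {n : ℕ} (b : Fin n → X) :
    ∑ i, m i ^ 2 / (∑ k, m k) +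
      ∑ i, m i ^ 2 / (∑ k, m k) *
        (stateWordProb T i (revWord b) -
          (∑ k, m k * stateWordProb T k (revWord b)) / ∑ k, m k) ^ 2 ≤
    ∑ a : Fin n → X, (∑ j, (m ᵥ* wordMatrix T (revWord a)) j ^ 2) /
      ∑ j, (m ᵥ* wordMatrix T (revWord a)) j := by
  set M := ∑ k, m k with hM
  set A : (Fin n → X) → ℝ := fun a => ∑ k, m k * stateWordProb T k (revWord a) with hA
  have hA0 : ∀ a, 0 ≤ A a := fun a =>
    Finset.sum_nonneg fun k _ => mul_nonneg (hm k) (hn.stateWordProb _ _)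
  have hAsum : ∑ a, A a = M := by
    rw [hA, Finset.sum_comm]
    simp_rw [← Finset.mul_sum, sum_stateWordProb hs, mul_one]
    rfl
  have hAM : ∀ a, A a ≤ M := fun a => hAsum ▸
    Finset.single_le_sum (f := A) (fun a _ => hA0 a) (Finset.mem_univ a)
  have pointwise : ∀ i a, m i ^ 2 * (2 * stateWordProb T i (revWord a) / M - A a / M ^ 2 +
      (stateWordProb T i (revWord a) - A a / M) ^ 2 / M) ≤
      m i ^ 2 * stateWordProb T i (revWord a) ^ 2 / A a := by
    intro i a
    rw [mul_div_assoc (m i ^ 2)]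
    rcases (hm i).eq_or_lt with h0 | hpos
    · simp [← h0]
    refine mul_le_mul_of_nonneg_left ?_ (sq_nonneg (m i))
    have hMpos : 0 < M := hpos.trans_le
      (Finset.single_le_sum (f := m) (fun k _ => hm k) (Finset.mem_univ i))
    rcases (hA0 a).eq_or_lt with hz | hApos
    · have : stateWordProb T i (revWord a) = 0 := by
        have := (Finset.sum_eq_zero_iff_of_nonneg
          fun k _ => mul_nonneg (hm k) (hn.stateWordProb k (revWord a))).1 hz.symm i
          (Finset.mem_univ i)
        exact (mul_eq_zero.1 this).resolve_left hpos.ne'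
      simp [this, ← hz]
    · have key : stateWordProb T i (revWord a) ^ 2 / A a =
          2 * stateWordProb T i (revWord a) / M - A a / M ^ 2 +
          (stateWordProb T i (revWord a) - A a / M) ^ 2 / A a := by
        field_simp
        ring
      rw [key]
      gcongr
      exact hAM a
  calc _ ≤ ∑ i, ∑ a : Fin n → X, m i ^ 2 * (2 * stateWordProb T i (revWord a) / M - A a / M ^ 2 +
        (stateWordProb T i (revWord a) - A a / M) ^ 2 / M) := by
        rw [← Finset.sum_add_distrib]
        refine Finset.sum_le_sum fun i _ => ?_
        rw [← Finset.mul_sum, Finset.sum_add_distrib, Finset.sum_sub_distrib, ← Finset.sum_div,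
          ← Finset.sum_div, ← Finset.mul_sum, sum_stateWordProb hs, hAsum]
        have h1 : (stateWordProb T i (revWord b) - A b / M) ^ 2 / M ≤
            ∑ a, (stateWordProb T i (revWord a) - A a / M) ^ 2 / M :=
          Finset.single_le_sum (f := fun a => (stateWordProb T i (revWord a) - A a / M) ^ 2 / M)
            (fun a _ => div_nonneg (sq_nonneg _) (Finset.sum_nonneg fun k _ => hm k))
            (Finset.mem_univ b)
        have h2 : 2 * 1 / M - M / M ^ 2 = 1 / M := by
          rcases eq_or_ne M 0 with h0 | h0
          · simp [h0]
          · field_simp; ring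
        rw [h2]
        calc _ = m i ^ 2 * (1 / M + (stateWordProb T i (revWord b) - A b / M) ^ 2 / M) := by ring
          _ ≤ _ := by gcongr
    _ ≤ ∑ i, ∑ a : Fin n → X, m i ^ 2 * stateWordProb T i (revWord a) ^ 2 / A a :=
        Finset.sum_le_sum fun i _ => Finset.sum_le_sum fun a _ => pointwise i a
    _ = ∑ a : Fin n → X, (∑ i, m i ^ 2 * stateWordProb T i (revWord a) ^ 2) / A a := by
        rw [Finset.sum_comm]; simp_rw [Finset.sum_div]
    _ ≤ _ := by
        refine Finset.sum_le_sum fun a _ => ?_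
        rw [sum_vecMul_wordMatrix]
        exact div_le_div_of_nonneg_right (sum_sq_le_sum_sq_vecMul hn h hm _) (hA0 a)

/-- A state distribution that no word can refine is concentrated on a single state. -/
lemma eq_single_of_forall_word (hd : ProbDistinct T) {φ : S → ℝ}
    (h1 : ∑ i, φ i = 1)
    (h : ∀ w : List X, ∀ i, φ i ^ 2 *
      (stateWordProb T i w - ∑ k, φ k * stateWordProb T k w) ^ 2 = 0) :
    ∃ j, φ = Pi.single j 1 := by
  obtain ⟨j, -, hj⟩ := Finset.exists_ne_zero_of_sum_ne_zero (h1.trans_ne one_ne_zero)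
  have heq : ∀ w, ∀ i, φ i ≠ 0 → stateWordProb T i w = ∑ k, φ k * stateWordProb T k w := by
    intro w i hi
    have := h w i
    simpa [hi, sub_eq_zero] using this
  have hz : ∀ k, k ≠ j → φ k = 0 := by
    intro k hk
    by_contra hne
    obtain ⟨w, -, hw⟩ := hd k j hk
    exact hw ((heq w k hne).trans (heq w j hj).symm)
  refine ⟨j, funext fun k => ?_⟩
  rw [Finset.sum_eq_single j (fun k _ => hz k) (by simp)] at h1
  rcases eq_or_ne k j with rfl | hk
  · simp [h1]
  · simp [hz k hk, hk]

lemma stationary_pos [Fintype X] (hn : HMMNonneg T) (hirr : Irreducible' T) {π : S → ℝ}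
    (hπ : IsStationaryDist T π) (i : S) : 0 < π i := by
  obtain ⟨h0, h1, hst⟩ := hπ
  obtain ⟨k, -, hk⟩ := Finset.exists_ne_zero_of_sum_ne_zero (h1.trans_ne one_ne_zero)
  have hpow : ∀ n, π ᵥ* totalT T ^ n = π := by
    intro n
    induction n with
    | zero => simp
    | succ n ih =>
      rw [pow_succ, ← vecMul_vecMul, ih]
      exact funext hst
  have hT0 : ∀ n a b, 0 ≤ (totalT T ^ n) a b := by
    intro n
    induction n with
    | zero => intro a b; rw [pow_zero, Matrix.one_apply]; split_ifs <;> norm_num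
    | succ n ih =>
      intro a b
      rw [pow_succ, Matrix.mul_apply]
      refine Finset.sum_nonneg fun c _ => mul_nonneg (ih a c) ?_
      rw [totalT, Matrix.sum_apply]
      exact Finset.sum_nonneg fun x _ => hn x c b
  obtain ⟨n, -, hpos⟩ := hirr k i
  rw [← hpow n]
  exact (mul_pos ((h0 k).lt_of_ne' hk) hpos).trans_le
    (Finset.single_le_sum (f := fun a => π a * (totalT T ^ n) a i)
      (fun a _ => mul_nonneg (h0 a) (hT0 n a i)) (Finset.mem_univ k))

lemma vecMul_totalT [Fintype X] {π : S → ℝ} (hπ : IsStationaryDist T π) (w : List X) :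
    ∑ x, π ᵥ* wordMatrix T (x :: w) = π ᵥ* wordMatrix T w := by
  have : π ᵥ* totalT T = π := funext hπ.2.2
  conv_rhs => rw [← this, totalT, vecMul_vecMul, Finset.sum_mul]
  simp_rw [wordMatrix_cons]
  ext j
  simp [vecMul, dotProduct, Matrix.sum_apply, Finset.mul_sum]
  exact Finset.sum_comm

end Algebra
end EM

namespace EM

open Matrix

section Past

variable {X : Type*}

lemma measurable_shift [MeasurableSpace X] : Measurable (shift : (ℤ → X) → (ℤ → X)) :=
  measurable_pi_lambda _ fun _ => measurable_pi_apply _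

lemma measurable_pastMap [MeasurableSpace X] : Measurable (pastMap : (ℤ → X) → (ℕ → X)) :=
  measurable_pi_lambda _ fun _ => measurable_pi_apply _

lemma shift_iterate_apply (t : ℕ) (ω : ℤ → X) (n : ℤ) : (shift^[t] ω) n = ω (n + t) := by
  induction t generalizing ω with
  | zero => simp
  | succ t ih =>
    rw [Function.iterate_succ_apply, ih, shift]
    congr 1
    push_cast
    ring

/-- The last `t` symbols of a past, most recent symbol first. -/
def lastSymbols (X : Type*) (t : ℕ) (p : ℕ → X) : Fin t → X := fun k => p k

lemma measurable_lastSymbols [MeasurableSpace X] (t : ℕ) : Measurable (lastSymbols X t) :=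
  measurable_pi_lambda _ fun _ => measurable_pi_apply _

lemma pastWord_eq_revWord_lastSymbols (p : ℕ → X) (t : ℕ) :
    pastWord p t = revWord (lastSymbols X t p) :=
  pastWord_eq_revWord p t

/-- The filtration whose `t`-th σ-algebra is generated by the last `t` symbols. -/
def pastFiltration (X : Type*) [MeasurableSpace X] :
    Filtration ℕ (inferInstance : MeasurableSpace (ℕ → X)) where
  seq t := MeasurableSpace.comap (lastSymbols X t) inferInstance
  mono' s t hst := by
    have : lastSymbols X s = (fun v k => v (Fin.castLE hst k)) ∘ lastSymbols X t := rfl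
    dsimp only
    rw [this, ← MeasurableSpace.comap_comp]
    exact MeasurableSpace.comap_mono
      (measurable_pi_lambda _ fun _ => measurable_pi_apply _).comap_le
  le' t := (measurable_lastSymbols t).comap_le

lemma wordProb_nonneg [MeasurableSpace X] {μ : Measure (ℤ → X)} (w : List X) :
    0 ≤ wordProb μ w :=
  ENNReal.toReal_nonneg

variable [MeasurableSpace X] [MeasurableSingletonClass X]

lemma wordProb_revWord {μ : Measure (ℤ → X)} (hstat : Stationary μ) {t : ℕ} (v : Fin t → X) :
    wordProb μ (revWord v) = ((pastMeasure μ).map (lastSymbols X t)).real {v} := by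
  have hmp : MeasurePreserving (shift^[t]) μ μ :=
    MeasurePreserving.iterate ⟨measurable_shift, hstat⟩ t
  have hA : MeasurableSet (pastMap ⁻¹' (lastSymbols X t ⁻¹' {v}) : Set (ℤ → X)) :=
    measurable_pastMap (measurable_lastSymbols t (measurableSet_singleton v))
  rw [measureReal_def, Measure.map_apply (measurable_lastSymbols t) (measurableSet_singleton v),
    pastMeasure, Measure.map_apply measurable_pastMap
      (measurable_lastSymbols t (measurableSet_singleton v)),
    ← hmp.measure_preimage hA.nullMeasurableSet, wordProb]
  congr 2
  ext ω
  have hl : (revWord v).length = t := by simp [revWord]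
  simp only [Set.mem_ofPred_eq, Set.mem_preimage, Set.mem_singleton_iff, funext_iff, lastSymbols,
    pastMap, shift_iterate_apply, List.get_eq_getElem]
  constructor
  · rintro h ⟨k, hk⟩
    have := h ⟨t - 1 - k, by rw [hl]; omega⟩
    simp only [revWord, List.getElem_reverse, List.getElem_ofFn, List.length_ofFn] at this
    convert this using 2
    · push_cast [show k ≤ t - 1 by omega, show 1 ≤ t by omega]
      ring
    · ext; simp; omega
  · rintro h ⟨k, hk⟩
    rw [hl] at hk
    have := h ⟨t - 1 - k, by omega⟩
    simp only [revWord, List.getElem_reverse, List.getElem_ofFn, List.length_ofFn]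
    convert this using 2
    push_cast [show k ≤ t - 1 by omega, show 1 ≤ t by omega]
    ring

variable [Fintype X]

lemma measurable_comp_pastWord {β : Type*} [MeasurableSpace β] (g : List X → β) (t : ℕ) :
    Measurable fun p : ℕ → X => g (pastWord p t) := by
  simp_rw [pastWord_eq_revWord_lastSymbols]
  exact (Measurable.of_discrete (f := fun v : Fin t → X => g (revWord v))).comp
    (measurable_lastSymbols t)

variable {μ : Measure (ℤ → X)} [IsProbabilityMeasure μ]

instance : IsProbabilityMeasure (pastMeasure μ) :=
  Measure.isProbabilityMeasure_map measurable_pastMap.aemeasurable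

lemma integrable_comp_lastSymbols {t : ℕ} (g : (Fin t → X) → ℝ) :
    Integrable (fun p => g (lastSymbols X t p)) (pastMeasure μ) :=
  (Integrable.of_finite (μ := (pastMeasure μ).map (lastSymbols X t)) (f := g)).comp_measurable
    (measurable_lastSymbols t)

lemma integral_comp_lastSymbols (hstat : Stationary μ) {t : ℕ} (g : (Fin t → X) → ℝ) :
    ∫ p, g (lastSymbols X t p) ∂pastMeasure μ = ∑ v, wordProb μ (revWord v) * g v := by
  rw [← integral_map (measurable_lastSymbols t).aemeasurable
    Measurable.of_discrete.aestronglyMeasurable, integral_fintype .of_finite]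
  simp_rw [wordProb_revWord hstat, smul_eq_mul]

lemma integral_comp_pastWord (hstat : Stationary μ) (t : ℕ) (g : List X → ℝ) :
    ∫ p, g (pastWord p t) ∂pastMeasure μ =
      ∑ v : Fin t → X, wordProb μ (revWord v) * g (revWord v) := by
  simp_rw [pastWord_eq_revWord_lastSymbols]
  exact integral_comp_lastSymbols hstat fun v => g (revWord v)

lemma integrable_comp_pastWord (t : ℕ) (g : List X → ℝ) :
    Integrable (fun p => g (pastWord p t)) (pastMeasure μ) := by
  simp_rw [pastWord_eq_revWord_lastSymbols]
  exact integrable_comp_lastSymbols fun v => g (revWord v)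

lemma ae_nontrivial (hstat : Stationary μ) : ∀ᵐ p ∂pastMeasure μ, Nontrivial' μ p := by
  refine ae_all_iff.2 fun t => ?_
  set g : List X → ℝ := fun w => if wordProb μ w = 0 then 1 else 0 with hg
  have h0 : ∫ p, g (pastWord p t) ∂pastMeasure μ = 0 := by
    rw [integral_comp_pastWord hstat]
    exact Finset.sum_eq_zero fun v _ => by simp [hg]
  rw [integral_eq_zero_iff_of_nonneg (fun p => by simp only [hg]; split_ifs <;> simp)
    (integrable_comp_pastWord t g)] at h0
  filter_upwards [h0] with p hp
  refine (wordProb_nonneg _).lt_of_ne' fun h => ?_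
  simp [hg, h] at hp

end Past

section StateClass

variable {X : Type*} [MeasurableSpace X] {μ : Measure (ℤ → X)}
  {S : Type*} [Fintype S] [DecidableEq S] {T : X → Matrix S S ℝ}

lemma mem_stateClass_iff {i : S} {q : ℕ → X} :
    q ∈ stateClass μ T i ↔ Nontrivial' μ q ∧ ∀ w : List X, w ≠ [] →
      Tendsto (fun t => condProb μ w (pastWord q t)) atTop (𝓝 (stateWordProb T i w)) := by
  constructor
  · rintro ⟨⟨hnt, hreg⟩, hp⟩
    exact ⟨hnt, fun w hw => hp w hw ▸ tendsto_nhds_limUnder (hreg w hw)⟩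
  · rintro ⟨hnt, h⟩
    exact ⟨⟨hnt, fun w hw => ⟨_, h w hw⟩⟩, fun w hw => (h w hw).limUnder_eq⟩

lemma eq_of_mem_stateClass (hd : ProbDistinct T) {i j : S} {q : ℕ → X}
    (hi : q ∈ stateClass μ T i) (hj : q ∈ stateClass μ T j) : i = j := by
  by_contra hne
  obtain ⟨w, hw, hne⟩ := hd i j hne
  exact hne (tendsto_nhds_unique ((mem_stateClass_iff.1 hi).2 w hw)
    ((mem_stateClass_iff.1 hj).2 w hw))

lemma measurableSet_stateClass [Fintype X] [MeasurableSingletonClass X] (i : S) :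
    MeasurableSet (stateClass μ T i) := by
  have : stateClass μ T i = (⋂ t, {q | 0 < wordProb μ (pastWord q t)}) ∩
      ⋂ w : List X, ⋂ _ : w ≠ [],
        {q | Tendsto (fun t => condProb μ w (pastWord q t)) atTop (𝓝 (stateWordProb T i w))} := by
    ext q
    simp [mem_stateClass_iff, Nontrivial']
  rw [this]
  refine (MeasurableSet.iInter fun t => ?_).inter
    (MeasurableSet.iInter fun w => MeasurableSet.iInter fun _ => ?_)
  · exact measurableSet_lt measurable_const (measurable_comp_pastWord (wordProb μ) t)
  · exact measurableSet_tendsto _ fun t => measurable_comp_pastWord (condProb μ w) t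

end StateClass

end EM

namespace EM

open Matrix

section Belief

variable {X : Type*} {S : Type*} [Fintype S] [DecidableEq S]

/-- The distribution of the current state of the hidden Markov model `T`, started from `π`,
conditional on having emitted the word `w`. -/
noncomputable def belief (T : X → Matrix S S ℝ) (π : S → ℝ) (w : List X) : S → ℝ := fun j =>
  (π ᵥ* wordMatrix T w) j / ∑ k, (π ᵥ* wordMatrix T w) k

/-- How well the word `w` discriminates the states in the support of `φ`. -/
noncomputable def discrimination (T : X → Matrix S S ℝ) (w : List X) (φ : S → ℝ) : ℝ :=
  ∑ i, φ i ^ 2 * (stateWordProb T i w - ∑ k, φ k * stateWordProb T k w) ^ 2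

variable {T : X → Matrix S S ℝ} {π : S → ℝ}

lemma discrimination_nonneg (w : List X) (φ : S → ℝ) : 0 ≤ discrimination T w φ :=
  Finset.sum_nonneg fun _ _ => mul_nonneg (sq_nonneg _) (sq_nonneg _)

lemma continuous_discrimination (w : List X) : Continuous (discrimination T w) := by
  unfold discrimination
  fun_prop

lemma vecMul_wordMatrix_nonneg (hn : HMMNonneg T) (hπ : ∀ i, 0 ≤ π i) (w : List X) (j : S) :
    0 ≤ (π ᵥ* wordMatrix T w) j :=
  Finset.sum_nonneg fun i _ => mul_nonneg (hπ i) (hn.wordMatrix w i j)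

lemma belief_mem_Icc (hn : HMMNonneg T) (hπ : ∀ i, 0 ≤ π i) (w : List X) :
    belief T π w ∈ Set.Icc (0 : S → ℝ) 1 :=
  have h0 := vecMul_wordMatrix_nonneg hn hπ w
  ⟨fun j => div_nonneg (h0 j) (Finset.sum_nonneg fun k _ => h0 k),
    fun j => div_le_one_of_le₀ (Finset.single_le_sum (fun k _ => h0 k) (Finset.mem_univ j))
      (Finset.sum_nonneg fun k _ => h0 k)⟩

lemma sum_mul_belief (hn : HMMNonneg T) (hπ : ∀ i, 0 ≤ π i) (w : List X) (j : S) :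
    (∑ k, (π ᵥ* wordMatrix T w) k) * belief T π w j = (π ᵥ* wordMatrix T w) j := by
  have h0 := vecMul_wordMatrix_nonneg hn hπ w
  refine mul_div_cancel_of_imp' fun h => ?_
  exact (Finset.sum_eq_zero_iff_of_nonneg fun k _ => h0 k).1 h j (Finset.mem_univ j)

lemma sum_vecMul_revWord [Fintype X] (hπ : IsStationaryDist T π) (t : ℕ) (j : S) :
    ∑ v : Fin t → X, (π ᵥ* wordMatrix T (revWord v)) j = π j := by
  induction t with
  | zero => simp [wordMatrix_nil]
  | succ t ih =>
    simp_rw [sum_revWord_succ, revWord_snoc, ← Finset.sum_apply, vecMul_totalT hπ]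
    simpa using ih

end Belief

/-- The process `μ` is generated by the hidden Markov model `T` started from `π`. -/
def Generates {X S : Type*} [MeasurableSpace X] [Fintype S] [DecidableEq S]
    (T : X → Matrix S S ℝ) (π : S → ℝ) (μ : Measure (ℤ → X)) : Prop :=
  ∀ w : List X, wordProb μ w = ∑ j, (π ᵥ* wordMatrix T w) j

section Generated

variable {X : Type*} [MeasurableSpace X] {S : Type*} [Fintype S] [DecidableEq S]
  {T : X → Matrix S S ℝ} {π : S → ℝ} {μ : Measure (ℤ → X)}

lemma generates_of_forall_ne_nil [Fintype X] [IsProbabilityMeasure μ] (hπ : IsStationaryDist T π)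
    (h : ∀ w : List X, w ≠ [] → wordProb μ w = ∑ j, ∑ i, π i * wordMatrix T w i j) :
    Generates T π μ := by
  intro w
  rcases eq_or_ne w [] with rfl | hw
  · simp [wordProb, wordMatrix_nil, hπ.2.1]
  · exact h w hw

lemma Generates.condProb_eq (h : Generates T π μ) (v w : List X) :
    condProb μ w v = ∑ k, belief T π v k * stateWordProb T k w := by
  rw [condProb, h, h, wordMatrix_append, ← vecMul_vecMul, sum_vecMul_wordMatrix, Finset.sum_div]
  exact Finset.sum_congr rfl fun k _ => by rw [belief]; ring

lemma Generates.sum_belief (h : Generates T π μ) {v : List X} (hv : 0 < wordProb μ v) :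
    ∑ k, belief T π v k = 1 := by
  rw [h] at hv
  simp_rw [belief]
  rw [← Finset.sum_div, div_self hv.ne']

lemma Generates.wordProb_pos_of_cons [Fintype X] (h : Generates T π μ)
    (hπ : IsStationaryDist T π) {x : X} {w : List X} (hw : 0 < wordProb μ (x :: w)) :
    0 < wordProb μ w := by
  refine hw.trans_le ?_
  rw [h w, ← vecMul_totalT hπ]
  simp_rw [Finset.sum_apply]
  rw [Finset.sum_comm]
  simp_rw [← h _]
  exact Finset.single_le_sum (f := fun y => wordProb μ (y :: w)) (fun y _ => wordProb_nonneg _)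
    (Finset.mem_univ x)

lemma Generates.mem_stateClass_of_tendsto (h : Generates T π μ) {p : ℕ → X}
    (hnt : Nontrivial' μ p) {j : S}
    (hp : Tendsto (fun t => belief T π (pastWord p t)) atTop (𝓝 (Pi.single j 1))) :
    p ∈ stateClass μ T j := by
  refine mem_stateClass_iff.2 ⟨hnt, fun w _ => ?_⟩
  simp_rw [h.condProb_eq]
  have := tendsto_finsetSum Finset.univ fun i _ =>
    ((tendsto_pi_nhds.1 hp) i).mul_const (stateWordProb T i w)
  simpa [Pi.single_apply] using this

lemma Generates.extendPast_mem_stateClass [Fintype X] (h : Generates T π μ)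
    (hgen : IsGenEM T) (hπ : IsStationaryDist T π) {i j : S} {q : ℕ → X} (hq : q ∈ stateClass μ T i) {x : X}
    (hx : 0 < T x i j) : extendPast q x ∈ stateClass μ T j := by
  obtain ⟨hn, -, -, hu, -⟩ := hgen
  obtain ⟨hnt, hlim⟩ := mem_stateClass_iff.1 hq
  have hPx : stateWordProb T i [x] = T x i j := by
    rw [stateWordProb_cons_of_pos hn hu hx, stateWordProb_nil, mul_one]
  have hpos : ∀ t, 0 < wordProb μ (pastWord q t ++ [x]) := by
    intro t
    obtain ⟨s, hs, hts⟩ := (((hlim [x] (by simp)).eventually_const_lt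
      (hPx ▸ hx)).and (eventually_ge_atTop t)).exists
    have hs' : 0 < wordProb μ (pastWord q s ++ [x]) :=
      (wordProb_nonneg _).lt_of_ne' fun h0 => by simp [condProb, h0] at hs
    clear hs
    induction s, hts using Nat.le_induction with
    | base => exact hs'
    | succ s _ ih =>
      refine ih (h.wordProb_pos_of_cons hπ (x := q s) ?_)
      simpa [pastWord, List.range_succ] using hs'
  refine mem_stateClass_iff.2 ⟨fun t => ?_, fun w _ => ?_⟩
  · cases t with
    | zero =>
      refine h.wordProb_pos_of_cons hπ (x := x) ?_
      simpa [pastWord] using hpos 0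
    | succ t => rw [pastWord_extendPast]; exact hpos t
  · rw [← tendsto_add_atTop_iff_nat 1]
    have hdiv := (hlim (x :: w) (by simp)).div (hlim [x] (by simp)) (hPx ▸ hx.ne')
    rw [hPx, stateWordProb_cons_of_pos hn hu hx, mul_div_cancel_left₀ _ hx.ne'] at hdiv
    refine hdiv.congr fun t => ?_
    rw [Pi.div_apply, pastWord_extendPast, condProb, condProb, condProb,
      div_div_div_cancel_right₀ (hnt t).ne', List.append_assoc, List.singleton_append]

variable [Fintype X] [MeasurableSingletonClass X] [IsProbabilityMeasure μ]

lemma Generates.integral_belief (h : Generates T π μ) (hstat : Stationary μ) (hn : HMMNonneg T)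
    (hπ : IsStationaryDist T π) (t : ℕ) (j : S) :
    ∫ p, belief T π (pastWord p t) j ∂pastMeasure μ = π j := by
  rw [integral_comp_pastWord hstat t fun w => belief T π w j, ← sum_vecMul_revWord hπ t j]
  exact Finset.sum_congr rfl fun v _ => by rw [h, sum_mul_belief hn hπ.1]

lemma Generates.martingale_belief (h : Generates T π μ) (hstat : Stationary μ)
    (hn : HMMNonneg T) (hπ : IsStationaryDist T π) (j : S) :
    Martingale (fun t p => belief T π (pastWord p t) j) (pastFiltration X) (pastMeasure μ) := by
  refine martingale_of_setIntegral_eq_succ (fun t => ?_)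
    (fun t => integrable_comp_pastWord t fun w => belief T π w j) ?_
  · simp_rw [pastWord_eq_revWord_lastSymbols]
    exact (Measurable.of_discrete (f := fun v : Fin t → X => belief T π (revWord v) j)
      |>.comp (comap_measurable (lastSymbols X t))).stronglyMeasurable
  · rintro t s ⟨B, hB, rfl⟩
    have hs := measurable_lastSymbols t hB
    rw [← integral_indicator hs, ← integral_indicator hs]
    have h1 := integral_comp_lastSymbols hstat (μ := μ)
      (B.indicator fun v : Fin t → X => belief T π (revWord v) j)
    have h2 := integral_comp_lastSymbols hstat (μ := μ)
      (fun u : Fin (t + 1) → X =>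
        B.indicator (fun _ => belief T π (revWord u) j) (Fin.init (α := fun _ => X) u))
    simp_rw [pastWord_eq_revWord_lastSymbols]
    refine (h1.trans ?_).trans h2.symm
    rw [sum_revWord_succ]
    refine Finset.sum_congr rfl fun v _ => ?_
    simp_rw [Fin.init_snoc, revWord_snoc]
    by_cases hv : v ∈ B
    · simp_rw [Set.indicator_of_mem hv, h _, sum_mul_belief hn hπ.1]
      rw [← Finset.sum_apply, vecMul_totalT hπ]
    · simp [Set.indicator_of_notMem hv]

lemma Generates.ae_tendsto_belief (h : Generates T π μ) (hstat : Stationary μ)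
    (hn : HMMNonneg T) (hπ : IsStationaryDist T π) :
    ∀ᵐ p ∂pastMeasure μ, ∃ φ : S → ℝ,
      Tendsto (fun t => belief T π (pastWord p t)) atTop (𝓝 φ) := by
  have hj : ∀ j, ∀ᵐ p ∂pastMeasure μ, ∃ c,
      Tendsto (fun t => belief T π (pastWord p t) j) atTop (𝓝 c) := fun j => by
    refine (h.martingale_belief hstat hn hπ j).submartingale.exists_ae_tendsto_of_bdd (R := 1)
      fun t => ?_
    refine (eLpNorm_le_of_ae_bound (C := 1) (ae_of_all _ fun p => ?_)).trans (by simp)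
    have hb := belief_mem_Icc hn hπ.1 (pastWord p t)
    rw [Real.norm_of_nonneg (hb.1 j)]
    exact hb.2 j
  filter_upwards [ae_all_iff.2 hj] with p hp
  choose φ hφ using hp
  exact ⟨φ, tendsto_pi_nhds.2 hφ⟩

/-- The expected purity of the conditional state distribution given the last `t` symbols. -/
noncomputable def expectedPurity (T : X → Matrix S S ℝ) (π : S → ℝ) (μ : Measure (ℤ → X))
    (t : ℕ) : ℝ :=
  ∫ p, ∑ j, belief T π (pastWord p t) j ^ 2 ∂pastMeasure μ

lemma Generates.expectedPurity_eq (h : Generates T π μ) (hstat : Stationary μ) (t : ℕ) :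
    expectedPurity T π μ t = ∑ v : Fin t → X, (∑ j, (π ᵥ* wordMatrix T (revWord v)) j ^ 2) /
      ∑ j, (π ᵥ* wordMatrix T (revWord v)) j := by
  rw [expectedPurity, integral_comp_pastWord hstat t fun w => ∑ j, belief T π w j ^ 2]
  refine Finset.sum_congr rfl fun v _ => ?_
  rw [h, Finset.mul_sum, Finset.sum_div]
  refine Finset.sum_congr rfl fun j _ => ?_
  rw [belief]
  rcases eq_or_ne (∑ k, (π ᵥ* wordMatrix T (revWord v)) k) 0 with h0 | h0
  · simp [h0]
  · field_simp

lemma Generates.expectedPurity_add_le (h : Generates T π μ) (hstat : Stationary μ)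
    (hn : HMMNonneg T) (hs : HMMStochastic T) (hu : Unifilar T) (hπ : IsStationaryDist T π)
    {n : ℕ} (b : Fin n → X) (t : ℕ) :
    expectedPurity T π μ t +
      ∫ p, discrimination T (revWord b) (belief T π (pastWord p t)) ∂pastMeasure μ ≤
    expectedPurity T π μ (n + t) := by
  rw [h.expectedPurity_eq hstat, h.expectedPurity_eq hstat,
    integral_comp_pastWord hstat t fun w => discrimination T (revWord b) (belief T π w),
    sum_revWord_add fun w => (∑ j, (π ᵥ* wordMatrix T w) j ^ 2) / ∑ j, (π ᵥ* wordMatrix T w) j,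
    ← Finset.sum_add_distrib]
  refine Finset.sum_le_sum fun v _ => ?_
  simp_rw [wordMatrix_append, ← vecMul_vecMul]
  refine le_trans (le_of_eq ?_)
    (purity_gain hn hs hu (vecMul_wordMatrix_nonneg hn hπ.1 (revWord v)) b)
  rw [Finset.sum_div, h, discrimination, Finset.mul_sum]
  congr 1
  refine Finset.sum_congr rfl fun i _ => ?_
  simp_rw [belief, div_mul_eq_mul_div, ← Finset.sum_div]
  rcases eq_or_ne (∑ k, (π ᵥ* wordMatrix T (revWord v)) k) 0 with h0 | h0
  · simp [h0]
  · field_simp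

lemma expectedPurity_le (hn : HMMNonneg T) (hπ : ∀ i, 0 ≤ π i) (t : ℕ) :
    expectedPurity T π μ t ≤ Fintype.card S := by
  refine (integral_mono (integrable_comp_pastWord t fun w => ∑ j, belief T π w j ^ 2)
    (integrable_const (Fintype.card S : ℝ)) fun p => ?_).trans (by simp)
  refine (Finset.sum_le_sum (g := fun _ => 1) fun j _ => ?_).trans (by simp)
  have hb := belief_mem_Icc hn hπ (pastWord p t)
  exact pow_le_one₀ (hb.1 j) (hb.2 j)

lemma Generates.tendsto_integral_discrimination (h : Generates T π μ) (hstat : Stationary μ)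
    (hn : HMMNonneg T) (hs : HMMStochastic T) (hu : Unifilar T) (hπ : IsStationaryDist T π)
    (w : List X) :
    Tendsto (fun t => ∫ p, discrimination T w (belief T π (pastWord p t)) ∂pastMeasure μ)
      atTop (𝓝 0) := by
  have hdisc : ∀ u t,
      0 ≤ ∫ p, discrimination T u (belief T π (pastWord p t)) ∂pastMeasure μ :=
    fun u t => integral_nonneg fun p => discrimination_nonneg _ _
  have hmono : Monotone (expectedPurity T π μ) := by
    obtain ⟨i, -, -⟩ := Finset.exists_ne_zero_of_sum_ne_zero (hπ.2.1.trans_ne one_ne_zero)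
    obtain ⟨x, -, -⟩ := Finset.exists_ne_zero_of_sum_ne_zero ((hs i).trans_ne one_ne_zero)
    refine monotone_nat_of_le_succ fun t => ?_
    have := h.expectedPurity_add_le hstat hn hs hu hπ (fun _ : Fin 1 => x) t
    rw [add_comm 1 t] at this
    linarith [hdisc (revWord fun _ : Fin 1 => x) t]
  have hlim := tendsto_atTop_ciSup hmono
    ⟨(Fintype.card S : ℝ), by rintro _ ⟨t, rfl⟩; exact expectedPurity_le hn hπ.1 t⟩
  have hdiff := ((tendsto_add_atTop_iff_nat w.reverse.length).2 hlim).sub hlim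
  rw [sub_self] at hdiff
  refine squeeze_zero (hdisc w) (fun t => ?_) hdiff
  have := h.expectedPurity_add_le hstat hn hs hu hπ (fun k => w.reverse.get k) t
  rw [revWord_get_reverse, add_comm _ t] at this
  linarith

/-- Almost every past determines the current state asymptotically. -/
lemma Generates.ae_tendsto_single (h : Generates T π μ) (hstat : Stationary μ)
    (hgen : IsGenEM T) (hπ : IsStationaryDist T π) :
    ∀ᵐ p ∂pastMeasure μ, ∃ j : S,
      Tendsto (fun t => belief T π (pastWord p t)) atTop (𝓝 (Pi.single j 1)) := by
  obtain ⟨hn, hs, -, hu, hd⟩ := hgen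
  have hlim := h.ae_tendsto_belief hstat hn hπ
  set φ : (ℕ → X) → S → ℝ := fun p => limUnder atTop fun t => belief T π (pastWord p t) with hφ
  have hφlim : ∀ᵐ p ∂pastMeasure μ,
      Tendsto (fun t => belief T π (pastWord p t)) atTop (𝓝 (φ p)) := by
    filter_upwards [hlim] with p hp using tendsto_nhds_limUnder hp
  have hmeas : ∀ w t, AEStronglyMeasurable
      (fun p => discrimination T w (belief T π (pastWord p t))) (pastMeasure μ) := fun w t =>
    (measurable_comp_pastWord (fun v => discrimination T w (belief T π v)) t).aestronglyMeasurable
  have hzero : ∀ w : List X, ∀ᵐ p ∂pastMeasure μ, discrimination T w (φ p) = 0 := by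
    intro w
    obtain ⟨C, hC⟩ := (isCompact_Icc (a := (0 : S → ℝ)) (b := 1)).exists_bound_of_continuousOn
      (continuous_discrimination (T := T) w).continuousOn
    have hpt : ∀ᵐ p ∂pastMeasure μ,
        Tendsto (fun t => discrimination T w (belief T π (pastWord p t))) atTop
          (𝓝 (discrimination T w (φ p))) := by
      filter_upwards [hφlim] with p hp
      exact ((continuous_discrimination w).tendsto _).comp hp
    have hbound : ∀ᵐ p ∂pastMeasure μ, ‖discrimination T w (φ p)‖ ≤ C := by
      filter_upwards [hφlim] with p hp
      exact hC _ (isClosed_Icc.mem_of_tendsto hp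
        (Eventually.of_forall fun t => belief_mem_Icc hn hπ.1 _))
    have hint : ∫ p, discrimination T w (φ p) ∂pastMeasure μ = 0 :=
      tendsto_nhds_unique (tendsto_integral_of_dominated_convergence (fun _ => C)
        (hmeas w) (integrable_const C)
        (fun t => ae_of_all _ fun p => hC _ (belief_mem_Icc hn hπ.1 _)) hpt)
        (h.tendsto_integral_discrimination hstat hn hs hu hπ w)
    exact (integral_eq_zero_iff_of_nonneg (fun p => discrimination_nonneg _ _)
      (Integrable.of_bound (aestronglyMeasurable_of_tendsto_ae atTop (hmeas w) hpt) C hbound)).1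
      hint
  filter_upwards [hφlim, ae_all_iff.2 hzero, ae_nontrivial hstat] with p hp hz hnt
  have h1 : ∑ i, φ p i = 1 := by
    refine tendsto_nhds_unique
      (tendsto_finsetSum _ fun i _ => (tendsto_pi_nhds.1 hp) i) ?_
    simp_rw [h.sum_belief (hnt _)]
    exact tendsto_const_nhds
  obtain ⟨j, hj⟩ := eq_single_of_forall_word hd h1 fun w i =>
    (Finset.sum_eq_zero_iff_of_nonneg fun i _ => mul_nonneg (sq_nonneg _) (sq_nonneg _)).1
      (hz w) i (Finset.mem_univ i)
  exact ⟨j, hj ▸ hp⟩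

lemma Generates.pastMeasure_stateClass (h : Generates T π μ) (hstat : Stationary μ)
    (hgen : IsGenEM T) (hπ : IsStationaryDist T π) (i : S) :
    pastMeasure μ (stateClass μ T i) = ENNReal.ofReal (π i) := by
  have hn := hgen.1
  have hpt : ∀ᵐ p ∂pastMeasure μ, Tendsto (fun t => belief T π (pastWord p t) i) atTop
      (𝓝 ((stateClass μ T i).indicator 1 p)) := by
    filter_upwards [h.ae_tendsto_single hstat hgen hπ, ae_nontrivial hstat] with p ⟨j, hj⟩ hnt
    have hmem := h.mem_stateClass_of_tendsto hnt hj
    have : (stateClass μ T i).indicator (1 : (ℕ → X) → ℝ) p = (Pi.single j 1 : S → ℝ) i := by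
      rcases eq_or_ne i j with rfl | hij
      · simp [hmem]
      · have : p ∉ stateClass μ T i := fun hi => hij (eq_of_mem_stateClass hgen.2.2.2.2 hi hmem)
        simp [this, hij]
    rw [this]
    exact tendsto_pi_nhds.1 hj i
  have hconv := tendsto_integral_of_dominated_convergence (fun _ => (1 : ℝ))
    (fun t => (measurable_comp_pastWord (fun w => belief T π w i) t).aestronglyMeasurable)
    (integrable_const _)
    (fun t => ae_of_all _ fun p => by
      have hb := belief_mem_Icc hn hπ.1 (pastWord p t)
      rw [Real.norm_of_nonneg (hb.1 i)]
      exact hb.2 i) hpt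
  simp_rw [h.integral_belief hstat hn hπ] at hconv
  rw [integral_indicator_one (measurableSet_stateClass i)] at hconv
  rw [tendsto_nhds_unique tendsto_const_nhds hconv, ofReal_measureReal]

end Generated

end EM

namespace EM

/-- If ℙ is the process generated by a generator ε-machine (T, π), then ℙ is
finitely characterized: each set E_i of regular pasts predicting like state σ_i is measurable
with ℙ⁻(E_i) = π_i > 0 and Σ_i ℙ⁻(E_i) = 1; moreover E_i ↔ σ_i is an HMM isomorphism:
𝐏(x|E_i) = 𝐏_{σ_i}(x), and whenever T^(x)_{ij} > 0 the pasts x⃖x for x⃖ ∈ E_i lie in E_j. -/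
theorem generator_is_history
    {X : Type*} [Fintype X] [MeasurableSpace X] [MeasurableSingletonClass X]
    {S : Type*} [Fintype S] [DecidableEq S]
    (T : X → Matrix S S ℝ) (hgen : IsGenEM T)
    (π : S → ℝ) (hπ : IsStationaryDist T π)
    (μ : Measure (ℤ → X)) [IsProbabilityMeasure μ] (hstat : Stationary μ)
    (hword : ∀ w : List X, w ≠ [] →
      wordProb μ w = ∑ j, ∑ i, π i * wordMatrix T w i j) :
    (∀ i : S, MeasurableSet (stateClass μ T i)) ∧
    (∀ i : S, 0 < π i ∧ pastMeasure μ (stateClass μ T i) = ENNReal.ofReal (π i)) ∧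
    (∑ i : S, pastMeasure μ (stateClass μ T i) = 1) ∧
    (∀ (i : S) (q : ℕ → X), q ∈ stateClass μ T i → ∀ x : X,
        predProb μ q [x] = stateWordProb T i [x]) ∧
    (∀ (i : S) (q : ℕ → X), q ∈ stateClass μ T i → ∀ (x : X) (j : S),
        0 < T x i j → extendPast q x ∈ stateClass μ T j) := by
  have h := generates_of_forall_ne_nil hπ hword
  have hmeas := h.pastMeasure_stateClass hstat hgen hπ
  refine ⟨measurableSet_stateClass,
    fun i => ⟨stationary_pos hgen.1 hgen.2.2.1 hπ i, hmeas i⟩, ?_,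
    fun i q hq x => hq.2 [x] (by simp),
    fun i q hq x j hx => h.extendPast_mem_stateClass hgen hπ hq hx⟩
  simp_rw [hmeas]
  rw [← ENNReal.ofReal_sum_of_nonneg fun i _ => hπ.1 i, hπ.2.1, ENNReal.ofReal_one]

end EM
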